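/- arXiv:quant-ph/0402136 — 2 statements merged into one kernel-verified Lean document; each statement's English description precedes it below -/
import Mathlib

section
/- (Stochastic LaSalle-type invariance, following Mao) Let x_t solve the Itô SDE dx_t = b(x_t)dt + σ(x_t)dW_t on ℝⁿ with locally Lipschitz coefficients, confined to a bounded invariant set G with x₀ ∈ G. If V : G → ℝ₊ is continuous, twice continuously differentiable, and its generator satisfies LV(x) ≤ 0 for all x ∈ G, where L = Σᵢ bⁱ ∂ᵢ + (1/2) Σᵢⱼ σⁱσʲ ∂ᵢ∂ⱼ, then LV(x_t) → 0 almost surely as t → ∞. -/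
open MeasureTheory Filter

noncomputable section

/-- The infinitesimal generator `L = Σᵢ bⁱ ∂ᵢ + ½ Σᵢⱼ σⁱ σʲ ∂ᵢ∂ⱼ` of the
Itô diffusion `dx_t = b(x_t) dt + σ(x_t) dW_t`. -/
def generator (n : ℕ) (b σ : (Fin n → ℝ) → (Fin n → ℝ))
    (f : (Fin n → ℝ) → ℝ) (y : Fin n → ℝ) : ℝ :=
  (∑ i, b y i * fderiv ℝ f y (Pi.single i 1)) +
    (1 / 2) * ∑ i, ∑ j, σ y i * σ y j *
      fderiv ℝ (fun z => fderiv ℝ f z (Pi.single j 1)) y (Pi.single i 1)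

theorem MeasureTheory.Martingale.setIntegral_mul_sub_eq_zero {Ω : Type*} {m : MeasurableSpace Ω}
    {P : Measure Ω} [IsProbabilityMeasure P] {ι : Type*} [Preorder ι] {𝓕 : Filtration ι m}
    {Z : ι → Ω → ℝ} (hZ : Martingale Z 𝓕 P) {i j : ι} (hij : i ≤ j) {g : Ω → ℝ}
    (hg : StronglyMeasurable[𝓕 i] g) {C : ℝ} (hC : ∀ ω, ‖g ω‖ ≤ C) {s : Set Ω}
    (hs : MeasurableSet[𝓕 i] s) :
    ∫ ω in s, g ω * (Z j ω - Z i ω) ∂P = 0 := by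
  have hsub : Integrable (Z j - Z i) P := (hZ.integrable j).sub (hZ.integrable i)
  have hint : Integrable (g * (Z j - Z i)) P :=
    hsub.bdd_mul (hg.mono (𝓕.le i)).aestronglyMeasurable (Eventually.of_forall hC)
  have hzero : P[g * (Z j - Z i) | 𝓕 i] =ᵐ[P] 0 := by
    filter_upwards [condExp_mul_of_stronglyMeasurable_left hg hint hsub,
      condExp_sub (hZ.integrable j) (hZ.integrable i) (𝓕 i), hZ.2 i j hij, hZ.2 i i le_rfl]
      with ω h₁ h₂ h₃ h₄
    simp [h₁, h₂, h₃, h₄]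
  calc ∫ ω in s, g ω * (Z j ω - Z i ω) ∂P = ∫ ω in s, (P[g * (Z j - Z i) | 𝓕 i]) ω ∂P :=
        (setIntegral_condExp (𝓕.le i) hint hs).symm
    _ = 0 := by rw [setIntegral_congr_ae₀ (g := fun _ => (0 : ℝ)) ((𝓕.le i _ hs).nullMeasurableSet)
        (hzero.mono fun ω h _ => h)]; simp

/-- The Bregman divergence of the convex function `v ↦ v⁻¹`. -/
def invDivergence (u v : ℝ) : ℝ := v⁻¹ - u⁻¹ + (u⁻¹) ^ 2 * (v - u)

theorem invDivergence_eq {u v : ℝ} (hu : u ≠ 0) (hv : v ≠ 0) :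
    invDivergence u v = v * (v⁻¹ - u⁻¹) ^ 2 := by
  unfold invDivergence
  field_simp
  ring

theorem invDivergence_nonneg {u v : ℝ} (hu : 0 < u) (hv : 0 < v) : 0 ≤ invDivergence u v := by
  rw [invDivergence_eq hu.ne' hv.ne']
  positivity

theorem sq_inv_sub_inv_le_invDivergence {u v : ℝ} (hu : 0 < u) (hv : 1 ≤ v) :
    (v⁻¹ - u⁻¹) ^ 2 ≤ invDivergence u v := by
  rw [invDivergence_eq hu.ne' (by positivity)]
  exact le_mul_of_one_le_left (sq_nonneg _) hv

section

variable {Ω : Type*} {m : MeasurableSpace Ω} {P : Measure Ω} {ι : Type*} [Preorder ι]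
  {𝓕 : Filtration ι m} {Z : ι → Ω → ℝ}

theorem inv_stronglyMeasurable_of_martingale (hZ : Martingale Z 𝓕 P) (i : ι) :
    StronglyMeasurable[𝓕 i] (fun ω => (Z i ω)⁻¹) :=
  (hZ.stronglyMeasurable i).measurable.inv.stronglyMeasurable

theorem norm_inv_le_one {z : ℝ} (hz : 1 ≤ z) : ‖z⁻¹‖ ≤ 1 := by
  rw [Real.norm_of_nonneg (by positivity)]
  exact inv_le_one_of_one_le₀ hz

theorem integrable_inv_sq_mul_sub_of_martingale (hZ : Martingale Z 𝓕 P) (h1 : ∀ i ω, 1 ≤ Z i ω)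
    (i j k : ι) : Integrable (fun ω => ((Z i ω)⁻¹) ^ 2 * (Z j ω - Z k ω)) P := by
  refine Integrable.bdd_mul (c := 1) ((hZ.integrable j).sub (hZ.integrable k))
    (((inv_stronglyMeasurable_of_martingale hZ i).pow 2).mono (𝓕.le i)).aestronglyMeasurable
    (Eventually.of_forall fun ω => ?_)
  rw [norm_pow]
  exact pow_le_one₀ (norm_nonneg _) (norm_inv_le_one (h1 i ω))

variable [IsProbabilityMeasure P]

theorem integrable_inv_of_martingale (hZ : Martingale Z 𝓕 P) (h1 : ∀ i ω, 1 ≤ Z i ω) (i : ι) :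
    Integrable (fun ω => (Z i ω)⁻¹) P :=
  .of_bound ((inv_stronglyMeasurable_of_martingale hZ i).mono (𝓕.le i)).aestronglyMeasurable 1
    (Eventually.of_forall fun ω => norm_inv_le_one (h1 i ω))

theorem integrable_invDivergence_of_martingale (hZ : Martingale Z 𝓕 P) (h1 : ∀ i ω, 1 ≤ Z i ω)
    (i j : ι) : Integrable (fun ω => invDivergence (Z i ω) (Z j ω)) P :=
  ((integrable_inv_of_martingale hZ h1 j).sub (integrable_inv_of_martingale hZ h1 i)).add
    (integrable_inv_sq_mul_sub_of_martingale hZ h1 i j i)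

theorem integral_invDivergence_of_martingale (hZ : Martingale Z 𝓕 P) (h1 : ∀ i ω, 1 ≤ Z i ω)
    {i j : ι} (hij : i ≤ j) :
    ∫ ω, invDivergence (Z i ω) (Z j ω) ∂P = ∫ ω, (Z j ω)⁻¹ ∂P - ∫ ω, (Z i ω)⁻¹ ∂P := by
  have h0 : ∫ ω, ((Z i ω)⁻¹) ^ 2 * (Z j ω - Z i ω) ∂P = 0 := by
    have := hZ.setIntegral_mul_sub_eq_zero hij (C := 1)
      ((inv_stronglyMeasurable_of_martingale hZ i).pow 2) (fun ω => by
        rw [Pi.pow_apply, norm_pow]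
        exact pow_le_one₀ (norm_nonneg _) (norm_inv_le_one (h1 i ω))) MeasurableSet.univ
    simpa using this
  have hadd := integral_add ((integrable_inv_of_martingale hZ h1 j).sub
    (integrable_inv_of_martingale hZ h1 i)) (integrable_inv_sq_mul_sub_of_martingale hZ h1 i j i)
  have hsub := integral_sub (integrable_inv_of_martingale hZ h1 j)
    (integrable_inv_of_martingale hZ h1 i)
  rw [h0, add_zero] at hadd
  exact hadd.trans hsub

theorem setIntegral_invDivergence_mono_of_martingale (hZ : Martingale Z 𝓕 P)
    (h1 : ∀ i ω, 1 ≤ Z i ω) {i j k : ι} (hij : i ≤ j) (hjk : j ≤ k) {s : Set Ω}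
    (hs : MeasurableSet[𝓕 j] s) :
    ∫ ω in s, invDivergence (Z i ω) (Z j ω) ∂P ≤ ∫ ω in s, invDivergence (Z i ω) (Z k ω) ∂P := by
  have hmeas : StronglyMeasurable[𝓕 j] (fun ω => (Z i ω)⁻¹ ^ 2 - (Z j ω)⁻¹ ^ 2) :=
    (((inv_stronglyMeasurable_of_martingale hZ i).mono (𝓕.mono hij)).pow 2).sub
      ((inv_stronglyMeasurable_of_martingale hZ j).pow 2)
  have h0 := hZ.setIntegral_mul_sub_eq_zero hjk (C := 1 + 1) hmeas (fun ω => by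
    refine (norm_sub_le _ _).trans (add_le_add ?_ ?_) <;> rw [norm_pow] <;>
      exact pow_le_one₀ (norm_nonneg _) (norm_inv_le_one (h1 _ ω))) hs
  have hI := fun l => integrable_invDivergence_of_martingale hZ h1 i l
  have hint : Integrable (fun ω => ((Z i ω)⁻¹ ^ 2 - (Z j ω)⁻¹ ^ 2) * (Z k ω - Z j ω)) P := by
    simpa only [sub_mul, Pi.sub_def] using (integrable_inv_sq_mul_sub_of_martingale hZ h1 i k j).sub
      (integrable_inv_sq_mul_sub_of_martingale hZ h1 j k j)
  rw [← sub_nonneg, ← integral_sub (hI k).integrableOn (hI j).integrableOn, ← h0]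
  refine integral_mono hint.integrableOn ((hI k).sub (hI j)).integrableOn fun ω => ?_
  have := invDivergence_nonneg (zero_lt_one.trans_le (h1 j ω)) (zero_lt_one.trans_le (h1 k ω))
  simp only [invDivergence] at this ⊢
  linarith

theorem monotone_integral_inv_of_martingale (hZ : Martingale Z 𝓕 P) (h1 : ∀ i ω, 1 ≤ Z i ω) :
    Monotone fun i => ∫ ω, (Z i ω)⁻¹ ∂P := fun i j hij => by
  rw [← sub_nonneg, ← integral_invDivergence_of_martingale hZ h1 hij]
  exact integral_nonneg fun ω =>
    invDivergence_nonneg (zero_lt_one.trans_le (h1 i ω)) (zero_lt_one.trans_le (h1 j ω))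

theorem integral_inv_le_one_of_martingale (hZ : Martingale Z 𝓕 P) (h1 : ∀ i ω, 1 ≤ Z i ω) (i : ι) :
    ∫ ω, (Z i ω)⁻¹ ∂P ≤ 1 := by
  have := integral_mono (integrable_inv_of_martingale hZ h1 i) (integrable_const (1 : ℝ))
    fun ω => inv_le_one_of_one_le₀ (h1 i ω)
  simpa using this

end

/-- The filtration obtained by sampling along a monotone sequence of times. -/
def MeasureTheory.Filtration.sample {Ω : Type*} {m : MeasurableSpace Ω} {ι κ : Type*} [Preorder ι]
    [Preorder κ] (𝓕 : Filtration ι m) (t : κ → ι) (ht : Monotone t) : Filtration κ m where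
  seq k := 𝓕 (t k)
  mono' _ _ h := 𝓕.mono (ht h)
  le' k := 𝓕.le (t k)

theorem measure_exists_le_of_submartingale {Ω : Type*} {m : MeasurableSpace Ω} {P : Measure Ω}
    [IsProbabilityMeasure P] {𝓖 : Filtration ℕ m} {Y : ℕ → Ω → ℝ} (hY : Submartingale Y 𝓖 P)
    (h0 : 0 ≤ Y) {δ : ℝ} (hδ : 0 < δ) (n : ℕ) :
    P {ω | ∃ k ≤ n, δ ≤ Y k ω} ≤ ENNReal.ofReal ((∫ ω, Y n ω ∂P) / δ) := by
  have hmax := maximal_ineq hY h0 (ε := δ.toNNReal) n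
  have hset : {ω | (δ.toNNReal : ℝ) ≤ (Finset.range (n + 1)).sup' Finset.nonempty_range_add_one
      fun k => Y k ω} = {ω | ∃ k ≤ n, δ ≤ Y k ω} := by
    ext ω
    simp [Finset.le_sup'_iff, Real.coe_toNNReal _ hδ.le]
  rw [hset] at hmax
  have hle : ∫ ω in {ω | ∃ k ≤ n, δ ≤ Y k ω}, Y n ω ∂P ≤ ∫ ω, Y n ω ∂P :=
    setIntegral_le_integral (hY.integrable n) (Eventually.of_forall (h0 n))
  rw [ENNReal.ofReal_div_of_pos hδ, ENNReal.le_div_iff_mul_le (by simp [hδ]) (by simp), mul_comm]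
  exact hmax.trans (ENNReal.ofReal_le_ofReal hle)

section

variable {Ω : Type*} {m : MeasurableSpace Ω} {P : Measure Ω} [IsProbabilityMeasure P]
  {𝓕 : Filtration ℝ m} {Z : ℝ → Ω → ℝ}

theorem measure_exists_lt_invDivergence_le (hZ : Martingale Z 𝓕 P) (h1 : ∀ t ω, 1 ≤ Z t ω)
    (hcont : ∀ ω, Continuous fun t => Z t ω) {L : ℝ} (hL : ∀ t, ∫ ω, (Z t ω)⁻¹ ∂P ≤ L) (T : ℝ)
    {δ : ℝ} (hδ : 0 < δ) :
    P {ω | ∃ s, T ≤ s ∧ δ < invDivergence (Z T ω) (Z s ω)} ≤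
      ENNReal.ofReal ((L - ∫ ω, (Z T ω)⁻¹ ∂P) / δ) := by
  have hpos : ∀ t ω, 0 < Z t ω := fun t ω => zero_lt_one.trans_le (h1 t ω)
  let τ : ℕ → ℕ → ℝ := fun p k => T + k / p
  have hτ : ∀ p, Monotone (τ p) := fun p a b hab => by dsimp only [τ]; gcongr
  have hTτ : ∀ p k, T ≤ τ p k := fun p k => le_add_of_nonneg_right (by positivity)
  let E : ℕ → Set Ω := fun p => {ω | ∃ k ≤ p ^ 2, δ ≤ invDivergence (Z T ω) (Z (τ p k) ω)}
  have hE : ∀ p, P (E p) ≤ ENNReal.ofReal ((L - ∫ ω, (Z T ω)⁻¹ ∂P) / δ) := fun p => by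
    have hsub : Submartingale (fun k ω => invDivergence (Z T ω) (Z (τ p k) ω))
        (𝓕.sample (τ p) (hτ p)) P := by
      refine submartingale_of_setIntegral_le (fun k => ?_)
        (fun k => integrable_invDivergence_of_martingale hZ h1 T (τ p k))
        (fun i j hij s hs => setIntegral_invDivergence_mono_of_martingale hZ h1 (hTτ p i)
          (hτ p hij) hs)
      have hT : StronglyMeasurable[𝓕 (τ p k)] (Z T) :=
        (hZ.stronglyMeasurable T).mono (𝓕.mono (hTτ p k))
      have hTinv : StronglyMeasurable[𝓕 (τ p k)] (fun ω => (Z T ω)⁻¹) :=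
        (inv_stronglyMeasurable_of_martingale hZ T).mono (𝓕.mono (hTτ p k))
      exact ((inv_stronglyMeasurable_of_martingale hZ (τ p k)).sub hTinv).add
        ((hTinv.pow 2).mul ((hZ.stronglyMeasurable (τ p k)).sub hT))
    refine (measure_exists_le_of_submartingale hsub
      (fun k ω => invDivergence_nonneg (hpos _ _) (hpos _ _)) hδ _).trans
      (ENNReal.ofReal_le_ofReal ?_)
    rw [integral_invDivergence_of_martingale hZ h1 (hTτ p _)]
    gcongr
    exact hL _
  have hmono : Monotone fun N => ⋂ p ≥ N, E p := fun a b hab =>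
    Set.biInter_mono (fun p (hp : b ≤ p) => hab.trans hp) fun _ _ => le_rfl
  have hsubset : {ω | ∃ s, T ≤ s ∧ δ < invDivergence (Z T ω) (Z s ω)} ⊆
      ⋃ N, ⋂ p ≥ N, E p := by
    rintro ω ⟨s, hs, hlt⟩
    have hlim : Tendsto (fun p : ℕ => τ p ⌊(s - T) * p⌋₊) atTop (nhds s) := by
      have := ((tendsto_nat_floor_mul_div_atTop (sub_nonneg.2 hs)).comp
        (tendsto_natCast_atTop_atTop (R := ℝ))).const_add T
      simpa [τ, Function.comp_def] using this
    have hcd : Tendsto (fun p : ℕ => invDivergence (Z T ω) (Z (τ p ⌊(s - T) * p⌋₊) ω)) atTop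
        (nhds (invDivergence (Z T ω) (Z s ω))) := by
      have hz := ((hcont ω).tendsto s).comp hlim
      exact ((hz.inv₀ (hpos s ω).ne').sub_const _).add ((hz.sub_const _).const_mul _)
    have hbig := (tendsto_natCast_atTop_atTop (R := ℝ)).eventually_ge_atTop (s - T)
    obtain ⟨N, hN⟩ := eventually_atTop.1 ((hcd.eventually (lt_mem_nhds hlt)).and hbig)
    simp only [Set.mem_iUnion, Set.mem_iInter]
    refine ⟨N, fun p hp => ⟨_, ?_, (hN p hp).1.le⟩⟩
    refine Nat.floor_le_of_le ?_
    push_cast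
    rw [pow_two]
    gcongr
    exact (hN p hp).2
  refine (measure_mono hsubset).trans ?_
  rw [hmono.measure_iUnion]
  exact iSup_le fun N => (measure_mono (Set.iInter₂_subset N le_rfl)).trans (hE N)

theorem ae_forall_exists_invDivergence_le (hZ : Martingale Z 𝓕 P) (h1 : ∀ t ω, 1 ≤ Z t ω)
    (hcont : ∀ ω, Continuous fun t => Z t ω) {δ : ℝ} (hδ : 0 < δ) :
    ∀ᵐ ω ∂P, ∃ T, ∀ s, T ≤ s → invDivergence (Z T ω) (Z s ω) ≤ δ := by
  obtain ⟨L, hLT⟩ : ∃ L, Tendsto (fun t => ∫ ω, (Z t ω)⁻¹ ∂P) atTop (nhds L) :=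
    ⟨_, tendsto_atTop_ciSup (monotone_integral_inv_of_martingale hZ h1)
      ⟨1, by rintro _ ⟨t, rfl⟩; exact integral_inv_le_one_of_martingale hZ h1 t⟩⟩
  have hL := (monotone_integral_inv_of_martingale hZ h1).ge_of_tendsto hLT
  have hlim : Tendsto (fun T => ENNReal.ofReal ((L - ∫ ω, (Z T ω)⁻¹ ∂P) / δ)) atTop (nhds 0) := by
    have := ENNReal.tendsto_ofReal ((hLT.const_sub L).div_const δ)
    simpa using this
  rw [ae_iff]
  refine le_antisymm (ge_of_tendsto' hlim fun T => (measure_mono fun ω hω => ?_).trans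
    (measure_exists_lt_invDivergence_le hZ h1 hcont hL T hδ)) zero_le
  simp only [Set.mem_ofPred_eq, not_exists, not_forall, not_le] at hω
  obtain ⟨s, hs, h⟩ := hω T
  exact ⟨s, hs, h⟩

/-- A martingale in continuous time with continuous paths, bounded below by `1`, converges almost
surely. -/
theorem ae_exists_tendsto_of_martingale_of_one_le (hZ : Martingale Z 𝓕 P) (h1 : ∀ t ω, 1 ≤ Z t ω)
    (hcont : ∀ ω, Continuous fun t => Z t ω) :
    ∀ᵐ ω ∂P, ∃ c, Tendsto (fun t => Z t ω) atTop (nhds c) := by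
  have hpos : ∀ t ω, 0 < Z t ω := fun t ω => zero_lt_one.trans_le (h1 t ω)
  have hdisc : ∀ᵐ ω ∂P, ∃ c, Tendsto (fun k : ℕ => Z k ω) atTop (nhds c) := by
    have hsub : Martingale (fun (k : ℕ) ω => Z k ω) (𝓕.sample (fun k : ℕ => (k : ℝ))
        Nat.mono_cast) P :=
      ⟨fun k => hZ.1 k, fun i j hij => hZ.2 i j (Nat.mono_cast hij)⟩
    refine hsub.submartingale.exists_ae_tendsto_of_bdd (R := (∫ ω, Z 0 ω ∂P).toNNReal) fun k => ?_
    rw [eLpNorm_one_eq_lintegral_enorm, ← ofReal_integral_norm_eq_lintegral_enorm (hZ.integrable k)]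
    refine ENNReal.ofReal_le_ofReal (le_of_eq ?_)
    have h := hZ.setIntegral_eq (Nat.cast_nonneg (α := ℝ) k) MeasurableSet.univ
    simp only [setIntegral_univ] at h
    rw [h]
    exact integral_congr_ae (Eventually.of_forall fun ω => Real.norm_of_nonneg (hpos k ω).le)
  have hall : ∀ᵐ ω ∂P, ∀ r : ℕ, ∃ T, ∀ s, T ≤ s →
      invDivergence (Z T ω) (Z s ω) ≤ (1 / (r + 1 : ℝ)) ^ 2 :=
    ae_all_iff.2 fun r => ae_forall_exists_invDivergence_le hZ h1 hcont (by positivity)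
  filter_upwards [hdisc, hall] with ω ⟨c, hc⟩ hω
  have hcauchy : Cauchy (map (fun t => (Z t ω)⁻¹) atTop) := by
    rw [Metric.cauchy_iff]
    refine ⟨inferInstance, fun ε hε => ?_⟩
    obtain ⟨r, hr⟩ := exists_nat_one_div_lt (half_pos hε)
    obtain ⟨T, hT⟩ := hω r
    have hd : ∀ s, T ≤ s → dist (Z s ω)⁻¹ (Z T ω)⁻¹ < ε / 2 := fun s hs =>
      (abs_le_of_sq_le_sq ((sq_inv_sub_inv_le_invDivergence (hpos T ω) (h1 s ω)).trans (hT s hs))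
        (by positivity)).trans_lt hr
    refine ⟨_, image_mem_map (Ici_mem_atTop T), ?_⟩
    rintro _ ⟨s, hs, rfl⟩ _ ⟨t, ht, rfl⟩
    exact (dist_triangle_right _ _ _).trans_lt
      ((add_lt_add (hd s hs) (hd t ht)).trans_eq (add_halves ε))
  obtain ⟨d, hd⟩ := CompleteSpace.complete hcauchy
  have hc1 : 1 ≤ c := ge_of_tendsto' hc fun k => h1 k ω
  have hdc : d = c⁻¹ := tendsto_nhds_unique
    (Tendsto.comp (show Tendsto (fun t => (Z t ω)⁻¹) atTop (nhds d) from hd)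
      tendsto_natCast_atTop_atTop) (hc.inv₀ (by positivity))
  refine ⟨d⁻¹, ?_⟩
  have := Tendsto.inv₀ (show Tendsto (fun t => (Z t ω)⁻¹) atTop (nhds d) from hd)
    (by rw [hdc]; positivity)
  simpa using this

end

section

variable {n : ℕ} {b σ : (Fin n → ℝ) → (Fin n → ℝ)}

theorem continuous_generator (hb : Continuous b) (hσ : Continuous σ) {f : (Fin n → ℝ) → ℝ}
    (hf : ContDiff ℝ 2 f) : Continuous (generator n b σ f) := by
  have h1 : ∀ v, ContDiff ℝ 1 fun z => fderiv ℝ f z v := fun v =>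
    (hf.fderiv_right (m := 1) (by norm_num)).clm_apply contDiff_const
  have h2 : ∀ v w, Continuous fun y => fderiv ℝ (fun z => fderiv ℝ f z v) y w := fun v w =>
    ((h1 v).continuous_fderiv (by norm_num)).clm_apply continuous_const
  have hb' := fun i => (continuous_apply i).comp hb
  have hσ' := fun i => (continuous_apply i).comp hσ
  refine (continuous_finsetSum _ fun i _ => (hb' i).mul (h1 _).continuous).add
    (continuous_const.mul (continuous_finsetSum _ fun i _ => continuous_finsetSum _ fun j _ =>
      ((hσ' i).mul (hσ' j)).mul (h2 _ _)))

theorem generator_add_const_mul {f g : (Fin n → ℝ) → ℝ} (hf : ContDiff ℝ 2 f)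
    (hg : ContDiff ℝ 2 g) (c : ℝ) (y : Fin n → ℝ) :
    generator n b σ (fun z => f z + c * g z) y = generator n b σ f y + c * generator n b σ g y := by
  have hd : ∀ {h : (Fin n → ℝ) → ℝ}, ContDiff ℝ 2 h → Differentiable ℝ h := fun hh =>
    hh.differentiable (by norm_num)
  have hd2 : ∀ {h : (Fin n → ℝ) → ℝ}, ContDiff ℝ 2 h → ∀ v,
      Differentiable ℝ fun z => fderiv ℝ h z v := fun hh v =>
    ((hh.fderiv_right (m := 1) (by norm_num)).clm_apply contDiff_const).differentiable (by norm_num)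
  have hadd : ∀ {p q : (Fin n → ℝ) → ℝ}, Differentiable ℝ p → Differentiable ℝ q → ∀ z v,
      fderiv ℝ (fun z => p z + c * q z) z v = fderiv ℝ p z v + c * fderiv ℝ q z v :=
    fun hp hq z v => by
      rw [fderiv_fun_add (hp z) ((hq z).const_mul c), fderiv_const_mul (hq z)]
      simp
  simp only [generator, hadd (hd hf) (hd hg), hadd (hd2 hf _) (hd2 hg _), mul_add,
    Finset.sum_add_distrib, Finset.mul_sum]
  have h₁ : ∀ i, b y i * (c * fderiv ℝ g y (Pi.single i 1)) =
      c * (b y i * fderiv ℝ g y (Pi.single i 1)) := fun i => by ring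
  have h₂ : ∀ i j, 1 / 2 * (σ y i * σ y j * (c *
      fderiv ℝ (fun z => fderiv ℝ g z (Pi.single j 1)) y (Pi.single i 1))) =
      c * (1 / 2 * (σ y i * σ y j *
        fderiv ℝ (fun z => fderiv ℝ g z (Pi.single j 1)) y (Pi.single i 1))) := fun i j => by ring
  simp only [h₁, h₂]
  ring

theorem generator_eq_zero_of_eventuallyEq {f : (Fin n → ℝ) → ℝ} {y : Fin n → ℝ}
    (hf : f =ᶠ[nhds y] 0) : generator n b σ f y = 0 := by
  have h1 : fderiv ℝ f =ᶠ[nhds y] fun _ => 0 := by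
    filter_upwards [hf.fderiv (𝕜 := ℝ)] with z hz
    rw [hz]
    exact fderiv_const_apply 0
  have h2 : ∀ v, fderiv ℝ (fun z => fderiv ℝ f z v) y = 0 := fun v => by
    have : (fun z => fderiv ℝ f z v) =ᶠ[nhds y] fun _ => 0 := h1.mono fun z hz => by simp [hz]
    rw [this.fderiv_eq]
    exact fderiv_const_apply 0
  simp [generator, h1.self_of_nhds, h2]

theorem exists_contDiff_zero_nhds_one_of_isClosed {E : Type*} [NormedAddCommGroup E]
    [NormedSpace ℝ E] [FiniteDimensional ℝ E] {s t : Set E} (hs : IsClosed s) (ht : IsClosed t)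
    (hd : Disjoint s t) :
    ∃ f : E → ℝ, ContDiff ℝ 2 f ∧ (∀ y ∈ s, f =ᶠ[nhds y] 0) ∧ (∀ y ∈ t, f y = 1) ∧
      ∀ y, 0 ≤ f y := by
  obtain ⟨f, hf0, hf1, hf⟩ :=
    exists_contMDiffMap_zero_one_nhds_of_isClosed (modelWithCornersSelf ℝ E) (n := 2) hs ht hd
  exact ⟨f, f.contMDiff.contDiff, fun y hy => (eventually_nhdsSet_iff_forall.1 hf0) y hy,
    fun y hy => hf1.self_of_nhdsSet y hy, fun y => (hf y).1⟩

end

theorem integral_Ioc_eq_intervalIntegral_max {g : ℝ → ℝ} (t : ℝ) :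
    ∫ s in Set.Ioc 0 t, g s = ∫ s in (0 : ℝ)..max 0 t, g s := by
  rw [intervalIntegral.integral_of_le (le_max_left _ _)]
  rcases le_total 0 t with h | h <;> simp [h]

theorem continuous_integral_Ioc {g : ℝ → ℝ} (hg : Continuous g) :
    Continuous fun t => ∫ s in Set.Ioc 0 t, g s := by
  simp only [integral_Ioc_eq_intervalIntegral_max]
  exact (intervalIntegral.continuous_primitive (fun _ _ => hg.intervalIntegrable _ _) 0).comp
    (continuous_const.max continuous_id)

theorem antitone_integral_Ioc {g : ℝ → ℝ} (hg : Continuous g) (h0 : ∀ s, g s ≤ 0) :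
    Antitone fun t => ∫ s in Set.Ioc 0 t, g s := fun t u htu => by
  have hint : ∀ v, IntegrableOn (fun s => -g s) (Set.Ioc 0 v) := fun v =>
    (hg.neg.integrableOn_Icc (a := 0) (b := v)).mono_set Set.Ioc_subset_Icc_self
  have := setIntegral_mono_set (hint u) (Eventually.of_forall fun s => neg_nonneg.2 (h0 s))
    (Set.Ioc_subset_Ioc_right htu).eventuallyLE
  simpa [integral_neg] using this

theorem tendsto_atBot_integral_Ioc {g : ℝ → ℝ} (hg : Continuous g) {ε : ℝ} (hε : 0 < ε)
    (h : ∀ᶠ t in atTop, g t ≤ -ε) : Tendsto (fun t => ∫ s in Set.Ioc 0 t, g s) atTop atBot := by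
  obtain ⟨T, hT⟩ := eventually_atTop.1 h
  have hint : ∀ a b, IntervalIntegrable g volume a b := fun a b => hg.intervalIntegrable a b
  have hlim : Tendsto (fun t => (∫ s in (0 : ℝ)..T, g s) + (t - T) * -ε) atTop atBot :=
    tendsto_atBot_add_const_left _ _ ((tendsto_atTop_add_const_right _ (-T)
      tendsto_id).atTop_mul_const_of_neg (neg_neg_of_pos hε))
  refine tendsto_atBot_mono' _ ?_ hlim
  filter_upwards [eventually_ge_atTop T, eventually_ge_atTop 0] with t ht h0
  rw [← intervalIntegral.integral_of_le h0, ← intervalIntegral.integral_add_adjacent_intervals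
    (hint 0 T) (hint T t)]
  have := intervalIntegral.integral_mono_on ht (hint T t) (intervalIntegrable_const (c := -ε))
    fun s hs => hT s hs.1
  rw [intervalIntegral.integral_const, smul_eq_mul] at this
  linarith

section

variable {n : ℕ} {b σ : (Fin n → ℝ) → (Fin n → ℝ)} {G : Set (Fin n → ℝ)} {Ω : Type*}
  {m : MeasurableSpace Ω} {P : Measure Ω} [IsProbabilityMeasure P] {𝓕 : Filtration ℝ m}
  {x : ℝ → Ω → (Fin n → ℝ)}

/-- Along a diffusion confined to a bounded set, a nonnegative function with nonpositive generator
converges, and so does the integral of its generator. -/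
theorem ae_exists_tendsto_of_generator_nonpos (hb : Continuous b) (hσ : Continuous σ)
    (hGbdd : Bornology.IsBounded G) (hinv : ∀ t ω, x t ω ∈ G)
    (hcont : ∀ ω, Continuous fun t => x t ω) {W : (Fin n → ℝ) → ℝ} (hW : ContDiff ℝ 2 W)
    (hmart : Martingale (fun t ω => W (x t ω) - W (x 0 ω) -
      ∫ s in Set.Ioc (0 : ℝ) t, generator n b σ W (x s ω)) 𝓕 P)
    (hW0 : ∀ y ∈ G, 0 ≤ W y) (hLW : ∀ y ∈ G, generator n b σ W y ≤ 0) :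
    ∀ᵐ ω ∂P, (∃ c, Tendsto (fun t => W (x t ω)) atTop (nhds c)) ∧
      ∃ c, Tendsto (fun t => ∫ s in Set.Ioc (0 : ℝ) t, generator n b σ W (x s ω)) atTop
        (nhds c) := by
  obtain ⟨K, hK⟩ := hGbdd.isCompact_closure.exists_bound_of_continuousOn hW.continuous.continuousOn
  have hgc : ∀ ω, Continuous fun t => generator n b σ W (x t ω) := fun ω =>
    (continuous_generator hb hσ hW).comp (hcont ω)
  let A : ℝ → Ω → ℝ := fun t ω => ∫ s in Set.Ioc (0 : ℝ) t, generator n b σ W (x s ω)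
  let Z : ℝ → Ω → ℝ := fun t ω => (W (x t ω) - W (x 0 ω) - A t ω) + (K + 1)
  have hZ : Martingale Z 𝓕 P := hmart.add (martingale_const 𝓕 P (K + 1))
  have hA : ∀ t ω, A t ω ≤ 0 := fun t ω => integral_nonpos fun s => hLW _ (hinv s ω)
  have hZA : ∀ t ω, 1 - A t ω ≤ Z t ω := fun t ω => by
    have h1 := hW0 _ (hinv t ω)
    have h2 := (le_abs_self _).trans (hK _ (subset_closure (hinv 0 ω)))
    dsimp only [Z]
    linarith
  have h1 : ∀ t ω, 1 ≤ Z t ω := fun t ω => by linarith [hZA t ω, hA t ω]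
  have hZc : ∀ ω, Continuous fun t => Z t ω := fun ω =>
    (((hW.continuous.comp (hcont ω)).sub continuous_const).sub
      (continuous_integral_Ioc (hgc ω))).add continuous_const
  filter_upwards [ae_exists_tendsto_of_martingale_of_one_le hZ h1 hZc] with ω ⟨c, hc⟩
  have hanti : Antitone fun t => A t ω := antitone_integral_Ioc (hgc ω) fun s => hLW _ (hinv s ω)
  obtain ⟨a, ha⟩ : ∃ a, Tendsto (fun t => A t ω) atTop (nhds a) := by
    rcases tendsto_atTop_of_antitone hanti with h | h
    · have hle : ∀ t, -(Z t ω) ≤ A t ω := fun t => by linarith [hZA t ω]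
      exact absurd hc.neg (not_tendsto_nhds_of_tendsto_atBot (tendsto_atBot_mono hle h) _)
    · exact h
  refine ⟨⟨c + a + W (x 0 ω) - (K + 1), ?_⟩, a, ha⟩
  convert ((hc.add ha).add_const (W (x 0 ω))).sub_const (K + 1) using 2 with t
  dsimp only [Z]
  ring

theorem ae_eventually_neg_lt_generator (hb : Continuous b) (hσ : Continuous σ)
    (hGbdd : Bornology.IsBounded G) (hinv : ∀ t ω, x t ω ∈ G)
    (hcont : ∀ ω, Continuous fun t => x t ω)
    (hmart : ∀ f : (Fin n → ℝ) → ℝ, ContDiff ℝ 2 f →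
      Martingale (fun t ω => f (x t ω) - f (x 0 ω) -
        ∫ s in Set.Ioc (0 : ℝ) t, generator n b σ f (x s ω)) 𝓕 P)
    {V : (Fin n → ℝ) → ℝ} (hV : ContDiff ℝ 2 V) (hV0 : ∀ y ∈ G, 0 ≤ V y)
    (hLV : ∀ y ∈ G, generator n b σ V y ≤ 0) {ε : ℝ} (hε : 0 < ε) :
    ∀ᵐ ω ∂P, ∀ᶠ t in atTop, -ε < generator n b σ V (x t ω) := by
  have hVc := continuous_generator hb hσ hV
  obtain ⟨ψ, hψ, hψ0, hψ1, hψnn⟩ := exists_contDiff_zero_nhds_one_of_isClosed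
    (s := {y | -(ε / 2) ≤ generator n b σ V y}) (t := {y | generator n b σ V y ≤ -ε})
    (isClosed_le continuous_const hVc) (isClosed_le hVc continuous_const)
    (Set.disjoint_left.2 fun y (h1 : -(ε / 2) ≤ _) (h2 : _ ≤ -ε) => by linarith)
  obtain ⟨K, hK⟩ := hGbdd.isCompact_closure.exists_bound_of_continuousOn
    (continuous_generator hb hσ hψ).continuousOn
  let c : ℝ := |K| / (ε / 2)
  have hc : 0 ≤ c := by positivity
  have hW : ContDiff ℝ 2 fun y => ψ y + c * V y := hψ.add (contDiff_const.mul hV)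
  have hLW : ∀ y ∈ G, generator n b σ (fun y => ψ y + c * V y) y ≤ 0 := fun y hy => by
    rw [generator_add_const_mul hψ hV]
    rcases le_or_gt (-(ε / 2)) (generator n b σ V y) with h | h
    · rw [generator_eq_zero_of_eventuallyEq (hψ0 y h), zero_add]
      exact mul_nonpos_of_nonneg_of_nonpos hc (hLV y hy)
    · have h1 : generator n b σ ψ y ≤ |K| :=
        ((le_abs_self _).trans (hK y (subset_closure hy))).trans (le_abs_self K)
      have h2 : c * generator n b σ V y ≤ c * -(ε / 2) := mul_le_mul_of_nonneg_left h.le hc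
      have h3 : c * (ε / 2) = |K| := div_mul_cancel₀ _ (by positivity)
      linarith
  filter_upwards [ae_exists_tendsto_of_generator_nonpos hb hσ hGbdd hinv hcont hV (hmart V hV)
      hV0 hLV, ae_exists_tendsto_of_generator_nonpos hb hσ hGbdd hinv hcont hW (hmart _ hW)
      (fun y hy => add_nonneg (hψnn y) (mul_nonneg hc (hV0 y hy))) hLW]
    with ω ⟨⟨v, hv⟩, a, ha⟩ ⟨⟨w, hw⟩, _⟩
  have hlim : Tendsto (fun t => ψ (x t ω)) atTop (nhds (w - c * v)) := by
    simpa using hw.sub (hv.const_mul c)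
  have hle : w - c * v ≤ 0 := by
    by_contra! hpos
    refine not_tendsto_nhds_of_tendsto_atBot (tendsto_atBot_integral_Ioc
      (hVc.comp (hcont ω)) (half_pos hε) ?_) a ha
    filter_upwards [hlim.eventually (lt_mem_nhds hpos)] with t ht
    by_contra! h
    exact ht.ne' (hψ0 _ h.le).self_of_nhds
  filter_upwards [hlim.eventually (gt_mem_nhds (hle.trans_lt one_pos))] with t ht
  by_contra! h
  exact ht.ne (hψ1 _ h)

end

/-- Stochastic LaSalle-type invariance theorem (Mao): if `x_t` solves the Itô
SDE `dx_t = b(x_t)dt + σ(x_t)dW_t` (formulated via the associated martingale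
problem: for every `C²` function `f`, `f(x_t) - f(x_0) - ∫₀ᵗ Lf(x_s) ds` is a
martingale) with locally Lipschitz coefficients, confined to a bounded
invariant set `G`, and `V ≥ 0` is `C²` with `LV ≤ 0` on `G`, then
`LV(x_t) → 0` almost surely as `t → ∞`. -/
theorem stochastic_lasalle
    (n : ℕ) (b σ : (Fin n → ℝ) → (Fin n → ℝ))
    (hb : LocallyLipschitz b) (hσ : LocallyLipschitz σ)
    (G : Set (Fin n → ℝ)) (hGbdd : Bornology.IsBounded G)
    (Ω : Type*) [m : MeasurableSpace Ω] (P : Measure Ω) [IsProbabilityMeasure P]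
    (𝓕 : Filtration ℝ m)
    (x : ℝ → Ω → (Fin n → ℝ))
    (hinv : ∀ t ω, x t ω ∈ G)
    (hcont : ∀ ω, Continuous fun t => x t ω)
    (hmart : ∀ f : (Fin n → ℝ) → ℝ, ContDiff ℝ 2 f →
      Martingale
        (fun t ω => f (x t ω) - f (x 0 ω) -
          ∫ s in Set.Ioc (0 : ℝ) t, generator n b σ f (x s ω)) 𝓕 P)
    (V : (Fin n → ℝ) → ℝ) (hV : ContDiff ℝ 2 V)
    (hVnonneg : ∀ y ∈ G, 0 ≤ V y)
    (hLV : ∀ y ∈ G, generator n b σ V y ≤ 0) :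
    ∀ᵐ ω ∂P, Tendsto (fun t => generator n b σ V (x t ω)) atTop (nhds 0) := by
  have hall : ∀ᵐ ω ∂P, ∀ r : ℕ, ∀ᶠ t in atTop, -(1 / (r + 1 : ℝ)) < generator n b σ V (x t ω) :=
    ae_all_iff.2 fun r => ae_eventually_neg_lt_generator hb.continuous hσ.continuous hGbdd hinv
      hcont hmart hV hVnonneg hLV (by positivity)
  filter_upwards [hall] with ω hω
  refine Metric.tendsto_nhds.2 fun ε hε => ?_
  obtain ⟨r, hr⟩ := exists_nat_one_div_lt hε
  filter_upwards [hω r] with t ht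
  rw [Real.dist_0_eq_abs, abs_of_nonpos (hLV _ (hinv t ω))]
  linarith

end
end

section
/- For the generator L = (G sin θ − (M/2) sin θ cos θ) d/dθ + (M/2) sin²θ d²/dθ² and the function Ṽ(θ) = −log(1 − cos θ) on (−π, π)\{0}, one has LṼ(θ) = cos²(θ/2)(M + M cos θ − 2G); consequently LṼ(θ) < 0 for all θ ∈ (−π, π)\{0} if and only if G ≥ M. -/
open Real

noncomputable section

/-- The generator `L = (G sin θ − (M/2) sin θ cos θ) d/dθ + (M/2) sin²θ d²/dθ²`
of the controlled diffusion on the circle. -/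
def circleGenerator (M G : ℝ) (f : ℝ → ℝ) (θ : ℝ) : ℝ :=
  (G * Real.sin θ - (M / 2) * Real.sin θ * Real.cos θ) * deriv f θ +
    (M / 2) * (Real.sin θ) ^ 2 * deriv (deriv f) θ

theorem one_sub_cos_pos_of_mem {θ : ℝ} (hθ : θ ∈ Set.Ioo (-π) π \ {0}) :
    0 < 1 - Real.cos θ := by
  obtain ⟨⟨h1, h2⟩, h0⟩ := hθ
  have hne : Real.cos θ ≠ 1 := fun h =>
    h0 ((Real.cos_eq_one_iff_of_lt_of_lt (by linarith [pi_pos]) (by linarith [pi_pos])).1 h)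
  exact sub_pos.2 (lt_of_le_of_ne (Real.cos_le_one θ) hne)

theorem hasDerivAt_neg_log_one_sub_cos {θ : ℝ} (h : 1 - Real.cos θ ≠ 0) :
    HasDerivAt (fun x => -Real.log (1 - Real.cos x))
      (-(Real.sin θ / (1 - Real.cos θ))) θ := by
  exact (((Real.hasDerivAt_cos θ).const_sub 1).log h).neg.congr_deriv (by rw [neg_neg])

theorem hasDerivAt_deriv_neg_log_one_sub_cos {θ : ℝ} (h : 1 - Real.cos θ ≠ 0) :
    HasDerivAt (deriv fun x => -Real.log (1 - Real.cos x)) (1 / (1 - Real.cos θ)) θ := by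
  have hev : (deriv fun x => -Real.log (1 - Real.cos x)) =ᶠ[nhds θ]
      fun x => -(Real.sin x / (1 - Real.cos x)) := by
    have hc : ContinuousAt (fun x => 1 - Real.cos x) θ := by fun_prop
    filter_upwards [hc.eventually_ne h] with x hx
    exact (hasDerivAt_neg_log_one_sub_cos hx).deriv
  refine HasDerivAt.congr_of_eventuallyEq ?_ hev
  refine ((Real.hasDerivAt_sin θ).div ((Real.hasDerivAt_cos θ).const_sub 1) h).neg.congr_deriv ?_
  field_simp
  linear_combination Real.sin_sq_add_cos_sq θ

theorem circleGenerator_neg_log_one_sub_cos (M G : ℝ) {θ : ℝ} (h : 1 - Real.cos θ ≠ 0) :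
    circleGenerator M G (fun x => -Real.log (1 - Real.cos x)) θ
      = (Real.cos (θ / 2)) ^ 2 * (M + M * Real.cos θ - 2 * G) := by
  have hhalf : Real.cos (θ / 2) ^ 2 = 1 / 2 + Real.cos θ / 2 := by
    rw [Real.cos_sq, mul_div_cancel₀ θ two_ne_zero]
  rw [circleGenerator, (hasDerivAt_neg_log_one_sub_cos h).deriv,
    (hasDerivAt_deriv_neg_log_one_sub_cos h).deriv, hhalf]
  field_simp
  linear_combination (M + M * Real.cos θ - 2 * G) * Real.sin_sq_add_cos_sq θ

/-- For `Ṽ(θ) = −log(1 − cos θ)` on `(−π, π) \ {0}` one has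
`LṼ(θ) = cos²(θ/2)(M + M cos θ − 2G)`; consequently `LṼ < 0` on all of
`(−π, π) \ {0}` if and only if `G ≥ M`. -/
theorem repelling_lyapunov_circle (M G : ℝ) (hM : 0 < M) (hG : 0 < G) :
    (∀ θ ∈ Set.Ioo (-π) π \ {0},
      circleGenerator M G (fun θ' => -Real.log (1 - Real.cos θ')) θ
        = (Real.cos (θ / 2)) ^ 2 * (M + M * Real.cos θ - 2 * G)) ∧
    ((∀ θ ∈ Set.Ioo (-π) π \ {0},
      circleGenerator M G (fun θ' => -Real.log (1 - Real.cos θ')) θ < 0)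
        ↔ M ≤ G) := by
  have key : ∀ θ ∈ Set.Ioo (-π) π \ {0},
      circleGenerator M G (fun θ' => -Real.log (1 - Real.cos θ')) θ
        = (Real.cos (θ / 2)) ^ 2 * (M + M * Real.cos θ - 2 * G) := fun θ hθ =>
    circleGenerator_neg_log_one_sub_cos M G (one_sub_cos_pos_of_mem hθ).ne'
  refine ⟨key, fun hneg => ?_, fun hMG θ hθ => ?_⟩
  · by_contra! hlt
    have h1 : 2 * G / M - 1 < 1 := by
      rw [sub_lt_iff_lt_add, div_lt_iff₀ hM]; linarith
    have h2 : -1 < 2 * G / M - 1 := by linarith [div_pos (mul_pos two_pos hG) hM]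
    have hpos : 0 < Real.arccos (2 * G / M - 1) := Real.arccos_pos.2 h1
    have hltpi : Real.arccos (2 * G / M - 1) < π :=
      lt_of_le_of_ne (Real.arccos_le_pi _) fun h => absurd (Real.arccos_eq_pi.1 h) h2.not_ge
    have hmem : Real.arccos (2 * G / M - 1) ∈ Set.Ioo (-π) π \ {0} :=
      ⟨⟨by linarith [pi_pos], hltpi⟩, hpos.ne'⟩
    have hzero : M + M * (2 * G / M - 1) - 2 * G = 0 := by
      field_simp
      ring
    have hcontra := hneg _ hmem
    rw [key _ hmem, Real.cos_arccos h2.le h1.le, hzero, mul_zero] at hcontra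
    exact lt_irrefl _ hcontra
  · rw [key θ hθ]
    have hcos : 0 < Real.cos (θ / 2) :=
      Real.cos_pos_of_mem_Ioo ⟨by linarith [hθ.1.1], by linarith [hθ.1.2]⟩
    refine mul_neg_of_pos_of_neg (pow_pos hcos 2) ?_
    linarith [mul_pos hM (one_sub_cos_pos_of_mem hθ)]

end
end
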